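/- Let g be a continuous, positive, non-increasing function on [0,∞) and let r ∈ ℕ. Assume conditions (6) hold, i.e., A_0, …, A_{r−1} are finite. Let M > 0, let 1 ≤ m ≤ r, and let h_m be an m-th antiderivative of g on [0, M] (h_m^{(m)} = g) which has m zeroes in [0, M]. Let γ_m be a zero of the function t ↦ P_m(t) − P_m(0) + h_m(0). Then |P_m(t) − P_m(0) + h_m(0)| ≤ |h_m(t)| for all t ∈ [0, γ_m]. -/

import Mathlib

open Set Filter MeasureTheory
open scoped Topology

noncomputable section

/-- Weighted sup-norm `‖x‖_{C(S),w} = sup_{t ∈ S} |x t| / w t`. -/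
def wNorm (x w : ℝ → ℝ) (S : Set ℝ) : ℝ :=
  sSup ((fun t => |x t| / w t) '' S)

/-- Sup-norm `‖x‖_{C(S)} = sup_{t ∈ S} |x t|`. -/
def supNorm (x : ℝ → ℝ) (S : Set ℝ) : ℝ :=
  sSup ((fun t => |x t|) '' S)

/-- `G` is a perfect `g`-spline of order `r` on `[0,a]` with exactly `m` knots
`u 1 < ⋯ < u m` (where `u 0 = 0` and `u (m+1) = a`) and sign `ε ∈ {1,-1}`:
`G ∈ C^{r-1}[0,a]`, and on each open interval between consecutive knots `G` is
`r` times differentiable with `G^{(r)}(t) = ε·(-1)^i·g(t)` there. -/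
def PerfectSplineWith (g : ℝ → ℝ) (r : ℕ) (a : ℝ) (m : ℕ) (u : ℕ → ℝ) (ε : ℝ)
    (G : ℝ → ℝ) : Prop :=
  (ε = 1 ∨ ε = -1) ∧ u 0 = 0 ∧ u (m + 1) = a ∧ (∀ i ≤ m, u i < u (i + 1)) ∧
  ContDiffOn ℝ (r - 1 : ℕ) G (Icc 0 a) ∧
  ∀ i ≤ m, ContDiffOn ℝ (r : ℕ) G (Ioo (u i) (u (i + 1))) ∧
    ∀ s ∈ Ioo (u i) (u (i + 1)),
      iteratedDerivWithin r G (Ioo (u i) (u (i + 1))) s = ε * (-1 : ℝ) ^ i * g s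

/-- `Γ^r_{n,g}[0,a]`: perfect `g`-splines of order `r` on `[0,a]` with at most `n` knots. -/
def InGamma (g : ℝ → ℝ) (r n : ℕ) (a : ℝ) (G : ℝ → ℝ) : Prop :=
  ∃ m ≤ n, ∃ u : ℕ → ℝ, ∃ ε : ℝ, PerfectSplineWith g r a m u ε G

/-- `b 1 < ⋯ < b (n+r+1)` are `n+r+1` oscillation points of `G` on `[0,a]`
with respect to the weight `f`, as in (5). -/
def OscPointsAt (f : ℝ → ℝ) (r n : ℕ) (a : ℝ) (G : ℝ → ℝ) (b : ℕ → ℝ) : Prop :=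
  0 ≤ b 1 ∧ b (n + r + 1) = a ∧ (∀ i, 1 ≤ i → i < n + r + 1 → b i < b (i + 1)) ∧
  ∀ i, 1 ≤ i → i ≤ n + r + 1 →
    G (b i) = (-1 : ℝ) ^ (i + r + 1) * (wNorm G f (Icc 0 a) * f (b i))

/-- `G` has `n+r+1` oscillation points on `[0,a]`. -/
def HasOsc (f : ℝ → ℝ) (r n : ℕ) (a : ℝ) (G : ℝ → ℝ) : Prop :=
  ∃ b : ℕ → ℝ, OscPointsAt f r n a G b

/-- `G` is the extremal spline `G_{r,n,f,a}`: a member of `Γ^r_{n,g}[0,a]`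
with `n+r+1` oscillation points. -/
def IsExtremalSpline (f g : ℝ → ℝ) (r n : ℕ) (a : ℝ) (G : ℝ → ℝ) : Prop :=
  InGamma g r n a G ∧ HasOsc f r n a G

/-- Iterated antiderivatives: `g_0 = g`, `g_{k+1}(t) = ∫_0^t g_k`. -/
def gk (g : ℝ → ℝ) : ℕ → ℝ → ℝ
  | 0 => g
  | k + 1 => fun t => ∫ s in (0:ℝ)..t, gk g k s

/-- The constants `A_k` of the paper:
`A_0 = ∫_0^∞ g`, and
`A_k = ∫_0^∞ [ Σ_{s=0}^{k-1} (-1)^{k-s-1} A_s t^{k-s-1}/(k-s-1)! + (-1)^k g_k(t) ] dt`. -/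
def Acoef (g : ℝ → ℝ) : ℕ → ℝ
  | 0 => ∫ t in Ioi (0 : ℝ), g t
  | k + 1 => ∫ t in Ioi (0 : ℝ),
      ((∑ s : Fin (k + 1), (-1 : ℝ) ^ (k - s.1) * Acoef g s.1 * t ^ (k - s.1) /
        (Nat.factorial (k - s.1) : ℝ)) + (-1 : ℝ) ^ (k + 1) * gk g (k + 1) t)

/-- `P_k(t) = Σ_{s=0}^{k-1} (-1)^{k-s-1} A_s t^{k-s-1}/(k-s-1)! + (-1)^k g_k(t)`. -/
def Pfun (g : ℝ → ℝ) (k : ℕ) (t : ℝ) : ℝ :=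
  (∑ s : Fin k, (-1 : ℝ) ^ (k - 1 - s.1) * Acoef g s.1 * t ^ (k - 1 - s.1) /
    (Nat.factorial (k - 1 - s.1) : ℝ)) + (-1 : ℝ) ^ k * gk g k t

/-- Conditions (6): `A_0 < ∞` and `A_k < ∞` for `k = 1, …, r-1`,
expressed as integrability of the corresponding integrands over `(0,∞)`. -/
def Cond6 (g : ℝ → ℝ) (r : ℕ) : Prop :=
  IntegrableOn g (Ioi 0) ∧ ∀ k, 1 ≤ k → k ≤ r - 1 → IntegrableOn (Pfun g k) (Ioi 0)

/-- Membership in the class `W^r_{f,g}(ℝ₊)`: `x ∈ C[0,∞)` with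
`‖x‖_{C[0,∞),f} < ∞`, `x ∈ C^{r-1}[0,∞)`, `x^{(r-1)}` locally absolutely
continuous with `|x^{(r)}| ≤ g` a.e., the latter encoded by the increment bound
`|x^{(r-1)}(t) - x^{(r-1)}(s)| ≤ ∫_s^t g`. -/
def MemW (f g : ℝ → ℝ) (r : ℕ) (x : ℝ → ℝ) : Prop :=
  ContinuousOn x (Ici 0) ∧
  ContDiffOn ℝ (r - 1 : ℕ) x (Ici 0) ∧
  BddAbove ((fun t => |x t| / f t) '' Ici 0) ∧
  ∀ s t : ℝ, 0 ≤ s → s ≤ t →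
    |iteratedDerivWithin (r - 1) x (Ici 0) t - iteratedDerivWithin (r - 1) x (Ici 0) s| ≤
      ∫ u in s..t, g u

/-- The modulus of continuity `ω(D^k, δ)` of the `k`-th differentiation operator on
`W^r_{f,g}(ℝ₊)`. -/
def omegaD (f g : ℝ → ℝ) (r k : ℕ) (δ : ℝ) : ℝ :=
  sSup {y | ∃ x : ℝ → ℝ, MemW f g r x ∧ wNorm x f (Ici 0) ≤ δ ∧
    y = supNorm (iteratedDerivWithin k x (Ici 0)) (Ici 0)}

/-- A perfect `g`-spline of order `r` on `[0,∞)` with exactly `n` knots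
`u 1 < ⋯ < u n` (and `u 0 = 0`), sign `ε`. -/
def PerfectSplineInf (g : ℝ → ℝ) (r n : ℕ) (u : ℕ → ℝ) (ε : ℝ) (Q : ℝ → ℝ) : Prop :=
  (ε = 1 ∨ ε = -1) ∧ u 0 = 0 ∧ (∀ i < n, u i < u (i + 1)) ∧
  ContDiffOn ℝ (r - 1 : ℕ) Q (Ici 0) ∧
  (∀ i < n, ContDiffOn ℝ (r : ℕ) Q (Ioo (u i) (u (i + 1))) ∧
    ∀ s ∈ Ioo (u i) (u (i + 1)),
      iteratedDerivWithin r Q (Ioo (u i) (u (i + 1))) s = ε * (-1 : ℝ) ^ i * g s) ∧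
  ContDiffOn ℝ (r : ℕ) Q (Ioi (u n)) ∧
  ∀ s ∈ Ioi (u n), iteratedDerivWithin r Q (Ioi (u n)) s = ε * (-1 : ℝ) ^ n * g s

end

lemma aux_int {f : ℝ → ℝ} (hf : ContinuousOn f (Ici 0)) (t : ℝ) (ht : 0 ≤ t) :
    HasDerivWithinAt (fun t => ∫ s in (0:ℝ)..t, f s) (f t) (Ici 0) t := by
  have hc : Continuous (fun s => f (max s 0)) := by
    have : ContinuousOn (f ∘ fun s : ℝ => max s 0) univ :=
      hf.comp (by fun_prop) (fun x _ => le_max_right x 0)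
    exact continuousOn_univ.1 this
  have h1 : HasDerivAt (fun t => ∫ s in (0:ℝ)..t, f (max s 0)) (f (max t 0)) t :=
    intervalIntegral.integral_hasDerivAt_right (hc.intervalIntegrable _ _)
      (hc.stronglyMeasurableAtFilter _ _) hc.continuousAt
  rw [max_eq_left ht] at h1
  refine h1.hasDerivWithinAt.congr_of_mem ?_ ht
  intro x hx
  apply intervalIntegral.integral_congr
  intro s hs
  rw [uIcc_of_le hx] at hs
  simp [max_eq_left hs.1]

lemma aux_gk_cont {g : ℝ → ℝ} (hg : ContinuousOn g (Ici 0)) (k : ℕ) :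
    ContinuousOn (gk g k) (Ici 0) := by
  induction k with
  | zero => simpa [gk] using hg
  | succ k ih =>
    intro t ht
    exact (aux_int ih t ht).continuousWithinAt

lemma aux_P_zero (g : ℝ → ℝ) : Pfun g 0 = g := by
  funext t; simp [Pfun, gk]

lemma aux_P_deriv {g : ℝ → ℝ} (hg : ContinuousOn g (Ici 0)) (k : ℕ) (t : ℝ) (ht : 0 ≤ t) :
    HasDerivWithinAt (Pfun g (k+1)) (-Pfun g k t) (Ici 0) t := by
  have h1 : HasDerivWithinAt (gk g (k+1)) (gk g k t) (Ici 0) t :=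
    aux_int (aux_gk_cont hg k) t ht
  have h2 : HasDerivAt (fun t : ℝ => ∑ s : Fin (k+1),
      (-1 : ℝ) ^ (k + 1 - 1 - s.1) * Acoef g s.1 * t ^ (k + 1 - 1 - s.1) /
    (Nat.factorial (k + 1 - 1 - s.1) : ℝ))
      (-∑ s : Fin k, (-1 : ℝ) ^ (k - 1 - s.1) * Acoef g s.1 * t ^ (k - 1 - s.1) /
    (Nat.factorial (k - 1 - s.1) : ℝ)) t := by
    simp only [Fin.sum_univ_castSucc]
    have h3 : ∀ s ∈ (Finset.univ : Finset (Fin k)), HasDerivAt (fun t : ℝ =>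
      (-1 : ℝ) ^ (k + 1 - 1 - (Fin.castSucc s).1) * Acoef g (Fin.castSucc s).1
        * t ^ (k + 1 - 1 - (Fin.castSucc s).1) /
      (Nat.factorial (k + 1 - 1 - (Fin.castSucc s).1) : ℝ))
      (-((-1 : ℝ) ^ (k - 1 - s.1) * Acoef g s.1 * t ^ (k - 1 - s.1) /
      (Nat.factorial (k - 1 - s.1) : ℝ))) t := by
      intro s _
      obtain ⟨n, hn⟩ : ∃ n, k = s.1 + 1 + n := ⟨k - (s.1+1), by omega⟩
      have e1 : k + 1 - 1 - (Fin.castSucc s).1 = n + 1 := by simp; omega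
      have e2 : k - 1 - s.1 = n := by omega
      rw [e1, e2]
      refine HasDerivAt.congr_deriv (((hasDerivAt_pow (n+1) t).const_mul
        ((-1 : ℝ) ^ (n+1) * Acoef g (Fin.castSucc s).1)).div_const
          ((Nat.factorial (n+1) : ℝ))) ?_
      have : (Nat.factorial n : ℝ) ≠ 0 := by positivity
      rw [Nat.factorial_succ]
      push_cast
      simp only [Fin.val_castSucc, Nat.add_sub_cancel]
      field_simp
      ring
    have h4 := HasDerivAt.fun_sum h3
    rw [Finset.sum_neg_distrib] at h4
    simpa using h4.add_const (Acoef g k)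
  have h5 := h2.hasDerivWithinAt.add (h1.const_mul ((-1:ℝ)^(k+1))) (s := Ici 0)
  have e : (-Pfun g k t) = (-∑ s : Fin k, (-1 : ℝ) ^ (k - 1 - s.1) * Acoef g s.1 *
      t ^ (k - 1 - s.1) / (Nat.factorial (k - 1 - s.1) : ℝ)) + (-1:ℝ)^(k+1) * gk g k t := by
    simp only [Pfun]; ring
  rw [e]
  exact h5

lemma aux_P_at_zero (g : ℝ → ℝ) (k : ℕ) : Pfun g (k+1) 0 = ∫ t in Ioi (0:ℝ), Pfun g k t := by
  have h1 : Pfun g (k+1) 0 = Acoef g k := by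
    simp only [Pfun, Fin.sum_univ_castSucc]
    rw [Finset.sum_eq_zero]
    · simp [gk]
    · intro s _
      have : k + 1 - 1 - (Fin.castSucc s).1 ≠ 0 := by
        have := s.2
        simp; omega
      rw [zero_pow this]; simp
  rw [h1]
  cases k with
  | zero => rw [aux_P_zero, Acoef]
  | succ k => rw [Acoef]; rfl

lemma aux_P_cont {g : ℝ → ℝ} (hg : ContinuousOn g (Ici 0)) (k : ℕ) :
    ContinuousOn (Pfun g k) (Ici 0) := by
  cases k with
  | zero => rwa [aux_P_zero]
  | succ k => exact fun t ht => (aux_P_deriv hg k t ht).continuousWithinAt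

lemma aux_P_derivAt {g : ℝ → ℝ} (hg : ContinuousOn g (Ici 0)) (k : ℕ) (t : ℝ) (ht : 0 < t) :
    HasDerivAt (Pfun g (k+1)) (-Pfun g k t) t :=
  (aux_P_deriv hg k t ht.le).hasDerivAt (Ici_mem_nhds ht)

lemma aux_P_anti {g : ℝ → ℝ} (hg : ContinuousOn g (Ici 0)) (k : ℕ)
    (hp : ∀ t, 0 ≤ t → 0 < Pfun g k t) : StrictAntiOn (Pfun g (k+1)) (Ici 0) := by
  apply strictAntiOn_of_deriv_neg (convex_Ici 0) (aux_P_cont hg _)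
  intro x hx
  rw [interior_Ici] at hx
  rw [(aux_P_derivAt hg k x hx).deriv]
  linarith [hp x (le_of_lt hx)]

lemma aux_P_pos {g : ℝ → ℝ} (hg : ContinuousOn g (Ici 0)) (hg_pos : ∀ t ∈ Ici (0:ℝ), 0 < g t)
    (r : ℕ) (h6 : Cond6 g r) (k : ℕ) (hk : k ≤ r) : ∀ t, 0 ≤ t → 0 < Pfun g k t := by
  induction k with
  | zero => rw [aux_P_zero]; exact hg_pos
  | succ k ih =>
    have hp := ih (by omega)
    have hi : IntegrableOn (Pfun g k) (Ioi 0) := by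
      rcases Nat.eq_zero_or_pos k with h0 | h0
      · rw [h0, aux_P_zero]; exact h6.1
      · exact h6.2 k h0 (by omega)
    have hanti := aux_P_anti hg k hp
    have hl := intervalIntegral_tendsto_integral_Ioi 0 hi tendsto_id
    have he : ∀ t : ℝ, 0 ≤ t → ∫ s in (0:ℝ)..t, Pfun g k s = Pfun g (k+1) 0 - Pfun g (k+1) t := by
      intro t ht
      have := intervalIntegral.integral_eq_sub_of_hasDerivAt_of_le (a := 0) (b := t)
        (f := fun t => -Pfun g (k+1) t) (f' := Pfun g k) ht
        ((aux_P_cont hg (k+1)).neg.mono Icc_subset_Ici_self)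
        (fun x hx => by
          have := (aux_P_derivAt hg k x hx.1).neg
          rw [neg_neg] at this
          exact this)
        (((aux_P_cont hg k).mono (by rw [uIcc_of_le ht]; exact Icc_subset_Ici_self)).intervalIntegrable)
      rw [this]; ring
    have hle : ∀ t : ℝ, 0 ≤ t → 0 ≤ Pfun g (k+1) t := by
      intro t ht
      rw [← aux_P_at_zero] at hl
      have : Pfun g (k+1) 0 - Pfun g (k+1) t ≤ Pfun g (k+1) 0 := by
        apply ge_of_tendsto hl
        filter_upwards [eventually_ge_atTop t] with x hx
        rw [id, he x (ht.trans hx)]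
        have := hanti.antitoneOn ht (ht.trans hx) hx
        linarith
      linarith
    intro t ht
    have h1 := hanti (a := t) (b := t+1) ht (by simp; linarith) (by linarith)
    have := hle (t+1) (by linarith)
    linarith

lemma aux_rolle {g : ℝ → ℝ} {M : ℝ} (hM : 0 < M) {j : ℕ} {h : ℝ → ℝ}
    (h_smooth : ContDiffOn ℝ ((j+1 : ℕ)) h (Icc 0 M))
    (h_deriv : ∀ t ∈ Icc (0:ℝ) M, iteratedDerivWithin (j+1) h (Icc 0 M) t = g t)
    (z : Fin (j+1) → ℝ) (hz : StrictMono z) (hz0 : ∀ i, z i ∈ Icc (0:ℝ) M ∧ h (z i) = 0) :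
    ContDiffOn ℝ (j : ℕ) (derivWithin h (Icc 0 M)) (Icc 0 M) ∧
    (∀ t ∈ Icc (0:ℝ) M, iteratedDerivWithin j (derivWithin h (Icc 0 M)) (Icc 0 M) t = g t) ∧
    ∃ w : Fin j → ℝ, StrictMono w ∧ (∀ i, w i ∈ Icc (0:ℝ) M ∧ derivWithin h (Icc 0 M) (w i) = 0) ∧
      ∀ i, z 0 ≤ w i := by
  have hu : UniqueDiffOn ℝ (Icc (0:ℝ) M) := uniqueDiffOn_Icc hM
  refine ⟨h_smooth.derivWithin hu (by norm_cast), ?_, ?_⟩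
  · intro t ht
    rw [← h_deriv t ht, iteratedDerivWithin_succ']
  · have key : ∀ i : Fin j, ∃ w ∈ Ioo (z i.castSucc) (z i.succ), deriv h w = 0 := by
      intro i
      apply exists_deriv_eq_zero (hz Fin.castSucc_lt_succ)
      · exact h_smooth.continuousOn.mono (Icc_subset_Icc (hz0 _).1.1 (hz0 _).1.2)
      · rw [(hz0 _).2, (hz0 _).2]
    choose w hw hw0 using key
    have hI : ∀ i, w i ∈ Ioo 0 M := fun i =>
      ⟨(hz0 _).1.1.trans_lt (hw i).1, (hw i).2.trans_le (hz0 _).1.2⟩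
    refine ⟨w, ?_, fun i => ⟨Ioo_subset_Icc_self (hI i), ?_⟩, fun i =>
      (hz.monotone (Fin.zero_le _)).trans (hw i).1.le⟩
    · intro a b hab
      refine (hw a).2.trans_le (le_trans (hz.monotone ?_) (hw b).1.le)
      rw [Fin.le_def]; simpa using hab
    · rw [derivWithin_of_mem_nhds (Icc_mem_nhds (hI i).1 (hI i).2), hw0]

lemma aux_main {g : ℝ → ℝ} (hg : ContinuousOn g (Ici 0)) (hg_pos : ∀ t ∈ Ici (0:ℝ), 0 < g t)
    (r : ℕ) (h6 : Cond6 g r) {M : ℝ} (hM : 0 < M) (j : ℕ) (hj : j ≤ r) : ∀ (h : ℝ → ℝ)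
    (_ : ContDiffOn ℝ (j : ℕ) h (Icc 0 M))
    (_ : ∀ t ∈ Icc (0:ℝ) M, iteratedDerivWithin j h (Icc 0 M) t = g t)
    (z : Fin j → ℝ) (_ : StrictMono z) (_ : ∀ i, z i ∈ Icc (0:ℝ) M ∧ h (z i) = 0)
    (b : ℝ) (_ : b ≤ M) (_ : ∀ i, b ≤ z i), ∀ t ∈ Icc 0 b,
      0 ≤ (-1:ℝ)^j * h t ∧ (-1:ℝ)^j * h t ≤ Pfun g j t := by
  induction j with
  | zero =>
    intro h _ hd z _ _ b hb _ t ht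
    have := hd t ⟨ht.1, ht.2.trans hb⟩
    rw [iteratedDerivWithin_zero] at this
    rw [aux_P_zero, this]
    simpa using (hg_pos t ht.1).le
  | succ j ih =>
    intro h hs hd z hz hz0 b hb hbz t ht
    obtain ⟨h1, h2, w, hw, hw0, hzw⟩ := aux_rolle hM hs hd z hz hz0
    have hD := ih (by omega) _ h1 h2 w hw hw0 (z 0) (hz0 0).1.2 hzw
    have hsub : Icc 0 (z 0) ⊆ Icc 0 M := Icc_subset_Icc_right (hz0 0).1.2
    have hder : ∀ x ∈ Ioo 0 (z 0), HasDerivAt h (derivWithin h (Icc 0 M) x) x := by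
      intro x hx
      have hx' : x ∈ Icc 0 M := hsub (Ioo_subset_Icc_self hx)
      exact ((hs.differentiableOn (by norm_cast)) x hx').hasDerivWithinAt.hasDerivAt
        (Icc_mem_nhds hx.1 (hx.2.trans_le (hz0 0).1.2))
    have htz : t ∈ Icc 0 (z 0) := ⟨ht.1, ht.2.trans (hbz 0)⟩
    have hzz : z 0 ∈ Icc 0 (z 0) := ⟨(hz0 0).1.1, le_rfl⟩
    have hc := hs.continuousOn.mono hsub
    constructor
    · have : AntitoneOn (fun x => (-1:ℝ)^(j+1) * h x) (Icc 0 (z 0)) := by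
        apply antitoneOn_of_hasDerivWithinAt_nonpos (convex_Icc _ _) (continuousOn_const.mul hc)
          (f' := fun x => (-1:ℝ)^(j+1) * derivWithin h (Icc 0 M) x)
        · intro x hx; rw [interior_Icc] at hx
          exact ((hder x hx).const_mul _).hasDerivWithinAt
        · intro x hx; rw [interior_Icc] at hx
          have := (hD x (Ioo_subset_Icc_self hx)).1
          rw [pow_succ]; linarith
      have := this htz hzz htz.2
      simpa [(hz0 0).2] using this
    · have : AntitoneOn (fun x => Pfun g (j+1) x - (-1:ℝ)^(j+1) * h x) (Icc 0 (z 0)) := by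
        apply antitoneOn_of_hasDerivWithinAt_nonpos (convex_Icc _ _)
          (((aux_P_cont hg _).mono Icc_subset_Ici_self).sub (continuousOn_const.mul hc))
          (f' := fun x => -Pfun g j x - (-1:ℝ)^(j+1) * derivWithin h (Icc 0 M) x)
        · intro x hx; rw [interior_Icc] at hx
          exact ((aux_P_derivAt hg j x hx.1).sub ((hder x hx).const_mul _)).hasDerivWithinAt
        · intro x hx; rw [interior_Icc] at hx
          have := (hD x (Ioo_subset_Icc_self hx)).2
          rw [pow_succ]; linarith
      have := this htz hzz htz.2
      simp only [(hz0 0).2] at this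
      have := aux_P_pos hg hg_pos r h6 (j+1) hj (z 0) (hz0 0).1.1
      linarith

/-- Lemma 3 (second inequality): if h_m is an m-th antiderivative of g on [0,M]
with m zeroes and γ_m is a zero of t ↦ P_m(t) - P_m(0) + h_m(0), then
|P_m(t) - P_m(0) + h_m(0)| ≤ |h_m(t)| on [0, γ_m]. -/
theorem statement9
    (g : ℝ → ℝ)
    (hg_c : ContinuousOn g (Ici 0)) (hg_pos : ∀ t ∈ Ici (0:ℝ), 0 < g t)
    (hg_anti : AntitoneOn g (Ici 0))
    (r : ℕ) (hr : 1 ≤ r) (h6 : Cond6 g r)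
    (M : ℝ) (hM : 0 < M) (m : ℕ) (hm1 : 1 ≤ m) (hm2 : m ≤ r)
    (h : ℝ → ℝ) (h_smooth : ContDiffOn ℝ (m : ℕ) h (Icc 0 M))
    (h_deriv : ∀ t ∈ Icc (0:ℝ) M, iteratedDerivWithin m h (Icc 0 M) t = g t)
    (h_zeroes : ∃ z : Fin m → ℝ, StrictMono z ∧ ∀ i, z i ∈ Icc (0:ℝ) M ∧ h (z i) = 0)
    (γ : ℝ) (hγ : γ ∈ Icc (0:ℝ) M) (hγ0 : Pfun g m γ - Pfun g m 0 + h 0 = 0) :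
    ∀ t ∈ Icc (0:ℝ) γ, |Pfun g m t - Pfun g m 0 + h 0| ≤ |h t| := by
  obtain ⟨j, rfl⟩ : ∃ j, m = j + 1 := ⟨m - 1, by omega⟩
  obtain ⟨z, hz, hz0⟩ := h_zeroes
  have hanti := aux_P_anti hg_c j (aux_P_pos hg_c hg_pos r h6 j (by omega))
  have hmain := aux_main hg_c hg_pos r h6 hM (j+1) hm2 h h_smooth h_deriv z hz hz0 (z 0)
    (hz0 0).1.2 (fun i => hz.monotone (Fin.zero_le _))
  have hsub : Icc 0 (z 0) ⊆ Icc 0 M := Icc_subset_Icc_right (hz0 0).1.2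
  have hz00 : 0 ≤ z 0 := (hz0 0).1.1
  intro t ht
  rcases Nat.even_or_odd (j+1) with he | ho
  · obtain ⟨h1, h2, w, hw, hw0, hzw⟩ := aux_rolle hM h_smooth h_deriv z hz hz0
    have hD := aux_main hg_c hg_pos r h6 hM j (by omega) _ h1 h2 w hw hw0 (z 0) (hz0 0).1.2 hzw
    have hmono : MonotoneOn (fun x => h x - Pfun g (j+1) x) (Icc 0 (z 0)) := by
      apply monotoneOn_of_hasDerivWithinAt_nonneg (convex_Icc _ _)
        ((h_smooth.continuousOn.mono hsub).sub ((aux_P_cont hg_c _).mono Icc_subset_Ici_self))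
        (f' := fun x => derivWithin h (Icc 0 M) x - -Pfun g j x)
      · intro x hx; rw [interior_Icc] at hx
        have hx' : x ∈ Icc 0 M := hsub (Ioo_subset_Icc_self hx)
        exact ((((h_smooth.differentiableOn (by norm_cast)) x hx').hasDerivWithinAt.hasDerivAt
          (Icc_mem_nhds hx.1 (hx.2.trans_le (hz0 0).1.2))).sub
            (aux_P_derivAt hg_c j x hx.1)).hasDerivWithinAt
      · intro x hx; rw [interior_Icc] at hx
        have := (hD x (Ioo_subset_Icc_self hx)).2
        have e : (-1:ℝ)^j = -1 := by
          have := he.neg_one_pow (α := ℝ)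
          rw [pow_succ] at this; linarith
        rw [e] at this
        linarith
    have hge : ∀ x ∈ Icc 0 (z 0), Pfun g (j+1) x - Pfun g (j+1) 0 + h 0 ≤ h x := by
      intro x hx
      have := hmono (left_mem_Icc.2 hz00) hx hx.1
      simp only at this
      linarith
    have hγz : γ ≤ z 0 := by
      by_contra hcon
      push Not at hcon
      have h3 := hge (z 0) (right_mem_Icc.2 hz00)
      rw [(hz0 0).2] at h3
      have := hanti (a := z 0) (b := γ) hz00 hγ.1 hcon
      linarith
    have h4 := hge t ⟨ht.1, ht.2.trans hγz⟩
    have h5 := hanti.antitoneOn (a := t) (b := γ) ht.1 hγ.1 ht.2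
    rw [abs_of_nonneg (by linarith)]
    exact h4.trans (le_abs_self _)
  · have h0 := (hmain 0 (left_mem_Icc.2 hz00)).1
    rw [ho.neg_one_pow] at h0
    have hγ1 : γ = 0 := by
      by_contra hne
      have := hanti (a := 0) (b := γ) self_mem_Ici hγ.1 (lt_of_le_of_ne hγ.1 (Ne.symm hne))
      linarith
    subst hγ1
    have : t = 0 := le_antisymm ht.2 ht.1
    subst this
    simp
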